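/- arXiv:1809.01417 — 5 statements merged into one kernel-verified Lean document; each statement's English description precedes it below -/
import Mathlib

section
/- Let n > 1 be a real number and let u, v : (0,∞) → ℝ be differentiable functions satisfying, for all r > 0, u'(r) + ((n−1)/r) u(r) = v(r) (u(r)² + v(r)²)^{1/(n−1)} and v'(r) = −u(r) (u(r)² + v(r)²)^{1/(n−1)}, together with the boundary conditions lim_{r→0⁺} r^{(n−1)/2} u(r) = 0 and lim_{r→0⁺} r^{(n−1)/2} v(r) = 0. Then either u and v are identically zero, or there exist λ > 0 and σ ∈ {+1, −1} such that for all r > 0: u(r) = σ λ^{-(n−1)/2} n^{(n−1)/2} (1 + (r/λ)²)^{-n/2} (r/λ) and v(r) = σ λ^{-(n−1)/2} n^{(n−1)/2} (1 + (r/λ)²)^{-n/2}. -/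
open Filter Topology

/-- A function with vanishing derivative on `(0, ∞)` is constant there. -/
lemma eq_of_hasDerivAt_zero_Ioi {f : ℝ → ℝ} (hf : ∀ r ∈ Set.Ioi (0 : ℝ), HasDerivAt f 0 r)
    {x y : ℝ} (hx : 0 < x) (hy : 0 < y) : f x = f y :=
  isOpen_Ioi.is_const_of_deriv_eq_zero isPreconnected_Ioi
    (fun r hr => (hf r hr).differentiableAt.differentiableWithinAt)
    (fun r hr => (hf r hr).deriv) hx hy

/-- If `ρ' = -2 (n - 1) u² / r` with `u² ≤ ρ`, then a zero of `ρ` on `(0, ∞)` forces `ρ = 0`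
there. -/
lemma eq_zero_of_hasDerivAt_neg_sq {n : ℝ} (hn : 1 < n) {u ρ : ℝ → ℝ}
    (hρ : ∀ r ∈ Set.Ioi (0 : ℝ), HasDerivAt ρ (-(2 * (n - 1) / r * u r ^ 2)) r)
    (hle : ∀ r, u r ^ 2 ≤ ρ r) {s : ℝ} (hs : 0 < s) (hs0 : ρ s = 0) {r : ℝ} (hr : 0 < r) :
    ρ r = 0 := by
  have hnonneg : ∀ r, 0 ≤ ρ r := fun r => (sq_nonneg _).trans (hle r)
  have hanti : AntitoneOn ρ (Set.Ioi 0) := by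
    refine antitoneOn_of_deriv_nonpos (convex_Ioi 0)
      (fun r hr => (hρ r hr).continuousAt.continuousWithinAt) ?_ ?_
    · rw [interior_Ioi]
      exact fun r hr => (hρ r hr).differentiableAt.differentiableWithinAt
    · rw [interior_Ioi]
      intro r hr
      have hr' : 0 < r := hr
      have : 0 < n - 1 := by linarith
      rw [(hρ r hr).deriv, neg_nonpos]
      positivity
  have hderiv : ∀ r ∈ Set.Ioi (0 : ℝ), HasDerivAt (fun r => r ^ (2 * (n - 1)) * ρ r)
      (r ^ (2 * (n - 1)) * (2 * (n - 1) / r * (ρ r - u r ^ 2))) r := by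
    intro r hr
    have hr' : 0 < r := hr
    refine ((Real.hasDerivAt_rpow_const (p := 2 * (n - 1)) (Or.inl hr'.ne')).mul
      (hρ r hr)).congr_deriv ?_
    rw [Real.rpow_sub_one hr'.ne']
    field_simp
    ring
  have hmono : MonotoneOn (fun r => r ^ (2 * (n - 1)) * ρ r) (Set.Ioi 0) := by
    refine monotoneOn_of_deriv_nonneg (convex_Ioi 0)
      (fun r hr => (hderiv r hr).continuousAt.continuousWithinAt) ?_ ?_
    · rw [interior_Ioi]
      exact fun r hr => (hderiv r hr).differentiableAt.differentiableWithinAt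
    · rw [interior_Ioi]
      intro r hr
      have hr' : 0 < r := hr
      have h1 : 0 < n - 1 := by linarith
      have h2 : 0 ≤ ρ r - u r ^ 2 := sub_nonneg.2 (hle r)
      rw [(hderiv r hr).deriv]
      positivity
  rcases le_total s r with h | h
  · exact le_antisymm (hs0 ▸ hanti hs hr h) (hnonneg r)
  · have h1 : r ^ (2 * (n - 1)) * ρ r ≤ s ^ (2 * (n - 1)) * ρ s := hmono hr hs h
    rw [hs0, mul_zero] at h1
    exact le_antisymm (nonpos_of_mul_nonpos_right h1 (Real.rpow_pos_of_pos hr _)) (hnonneg r)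

/-- The Hamiltonian of the system vanishes on solutions with the given behaviour at the origin. -/
lemma hamiltonian_eq_zero {n : ℝ} (hn : 1 < n) {u v : ℝ → ℝ}
    (hu : ∀ r ∈ Set.Ioi (0 : ℝ), HasDerivAt u
      (v r * (u r ^ 2 + v r ^ 2) ^ ((1 : ℝ) / (n - 1)) - (n - 1) / r * u r) r)
    (hv : ∀ r ∈ Set.Ioi (0 : ℝ), HasDerivAt v
      (-(u r * (u r ^ 2 + v r ^ 2) ^ ((1 : ℝ) / (n - 1)))) r)
    (hρ : ∀ r ∈ Set.Ioi (0 : ℝ), HasDerivAt (fun r => u r ^ 2 + v r ^ 2)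
      (-(2 * (n - 1) / r * u r ^ 2)) r)
    (hpos : ∀ r ∈ Set.Ioi (0 : ℝ), 0 < u r ^ 2 + v r ^ 2)
    (hu0 : Tendsto (fun r : ℝ => r ^ ((n - 1) / 2) * u r) (𝓝[>] 0) (𝓝 0))
    (hv0 : Tendsto (fun r : ℝ => r ^ ((n - 1) / 2) * v r) (𝓝[>] 0) (𝓝 0))
    {r : ℝ} (hr : 0 < r) :
    r * ((u r ^ 2 + v r ^ 2) ^ ((1 : ℝ) / (n - 1)) * (u r ^ 2 + v r ^ 2)) = n * (u r * v r) := by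
  have hn1 : 0 < n - 1 := by linarith
  set E : ℝ → ℝ := fun r => r ^ (n - 1) *
    (r * (u r ^ 2 + v r ^ 2) ^ ((1 : ℝ) / (n - 1) + 1) - n * (u r * v r)) with hE
  have hderiv : ∀ r ∈ Set.Ioi (0 : ℝ), HasDerivAt E 0 r := by
    intro r hr
    have hr' : 0 < r := hr
    have h1 := (hρ r hr).rpow_const (p := (1 : ℝ) / (n - 1) + 1) (Or.inl (hpos r hr).ne')
    refine ((Real.hasDerivAt_rpow_const (p := n - 1) (Or.inl hr'.ne')).mul
      (((hasDerivAt_id r).mul h1).sub (((hu r hr).mul (hv r hr)).const_mul n))).congr_deriv ?_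
    simp only [Pi.mul_apply, Pi.sub_apply, id]
    rw [Real.rpow_sub_one hr'.ne', add_sub_cancel_right, Real.rpow_add_one (hpos r hr).ne']
    field_simp
    ring
  have hlim : Tendsto E (𝓝[>] 0) (𝓝 0) := by
    have hp : 0 < (1 : ℝ) / (n - 1) + 1 := by positivity
    have h := ((((hu0.pow 2).add (hv0.pow 2)).rpow_const (p := (1 : ℝ) / (n - 1) + 1)
      (Or.inr hp.le))).sub ((hu0.mul hv0).const_mul n)
    have hz : ((0 : ℝ) ^ 2 + 0 ^ 2) ^ ((1 : ℝ) / (n - 1) + 1) - n * (0 * 0) = 0 := by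
      rw [zero_pow two_ne_zero, add_zero, Real.zero_rpow hp.ne']
      ring
    rw [hz] at h
    refine h.congr' ?_
    filter_upwards [self_mem_nhdsWithin] with r hr
    have hr' : 0 < r := hr
    have hsq : (r ^ ((n - 1) / 2)) ^ 2 = r ^ (n - 1) := by
      rw [← Real.rpow_natCast, ← Real.rpow_mul hr'.le]
      norm_num
    have h2 : (r ^ (n - 1)) ^ ((1 : ℝ) / (n - 1) + 1) = r ^ (n - 1) * r := by
      rw [← Real.rpow_mul hr'.le, ← Real.rpow_add_one hr'.ne']
      congr 1
      field_simp
      ring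
    have h3 : (r ^ ((n - 1) / 2) * u r) ^ 2 + (r ^ ((n - 1) / 2) * v r) ^ 2
        = r ^ (n - 1) * (u r ^ 2 + v r ^ 2) := by
      rw [← hsq]; ring
    rw [h3, Real.mul_rpow (by positivity) (hpos r hr).le, h2, hE]
    simp only
    rw [← hsq]
    ring
  have hconst : Tendsto E (𝓝[>] 0) (𝓝 (E r)) := by
    refine tendsto_const_nhds.congr' ?_
    filter_upwards [self_mem_nhdsWithin] with s hs
    exact eq_of_hasDerivAt_zero_Ioi hderiv hr hs
  have h0 : E r = 0 := tendsto_nhds_unique hconst hlim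
  rw [← Real.rpow_add_one (hpos r hr).ne']
  exact sub_eq_zero.1 ((mul_eq_zero.1 h0).resolve_left (Real.rpow_pos_of_pos hr _).ne')

/-- Solving the vanishing Hamiltonian relation for `v²` once `u = (r / lam) v`. -/
lemma sq_eq_of_hamiltonian_eq_zero {n lam r x y : ℝ} (hn : 1 < n) (hlam : 0 < lam) (hr : 0 < r)
    (hxy : x = r / lam * y) (hpos : 0 < x ^ 2 + y ^ 2)
    (hH : r * ((x ^ 2 + y ^ 2) ^ ((1 : ℝ) / (n - 1)) * (x ^ 2 + y ^ 2)) = n * (x * y)) :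
    y ^ 2 = (lam ^ (-(n - 1) / 2) * n ^ ((n - 1) / 2) * (1 + (r / lam) ^ 2) ^ (-n / 2)) ^ 2 := by
  have hn0 : 0 < n := by linarith
  have hn1 : 0 < n - 1 := by linarith
  have hD : 0 < 1 + (r / lam) ^ 2 := by positivity
  have hρ : x ^ 2 + y ^ 2 = y ^ 2 * (1 + (r / lam) ^ 2) := by rw [hxy]; ring
  have hy : 0 < y ^ 2 := by
    rw [hρ] at hpos
    exact pos_of_mul_pos_left hpos hD.le
  have hpow : (x ^ 2 + y ^ 2) ^ ((1 : ℝ) / (n - 1)) = lam⁻¹ * n * (1 + (r / lam) ^ 2)⁻¹ := by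
    have h1 : (x ^ 2 + y ^ 2) ^ ((1 : ℝ) / (n - 1)) * (1 + (r / lam) ^ 2) * (r * y ^ 2)
        = lam⁻¹ * n * (r * y ^ 2) := by
      calc _ = r * ((x ^ 2 + y ^ 2) ^ ((1 : ℝ) / (n - 1)) * (x ^ 2 + y ^ 2)) := by
            nth_rewrite 3 [hρ]; ring
        _ = _ := by rw [hH, hxy]; ring
    exact (eq_mul_inv_iff_mul_eq₀ hD.ne').2 (mul_right_cancel₀ (by positivity) h1)
  have hsum : x ^ 2 + y ^ 2 = (lam⁻¹ * n * (1 + (r / lam) ^ 2)⁻¹) ^ (n - 1) := by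
    rw [← hpow, ← Real.rpow_mul hpos.le, one_div_mul_cancel hn1.ne', Real.rpow_one]
  have hsq : ∀ {z : ℝ} (p : ℝ), 0 < z → (z ^ (p / 2)) ^ 2 = z ^ p := by
    intro z p hz
    rw [← Real.rpow_natCast, ← Real.rpow_mul hz.le]
    norm_num
  rw [mul_pow, mul_pow, hsq _ hlam, hsq _ hn0, hsq _ hD]
  rw [Real.mul_rpow (by positivity) (by positivity), Real.mul_rpow (by positivity) hn0.le,
    Real.inv_rpow hlam.le, Real.inv_rpow hD.le, hρ] at hsum
  rw [Real.rpow_neg hlam.le, Real.rpow_neg hD.le,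
    show (1 + (r / lam) ^ 2) ^ n = (1 + (r / lam) ^ 2) ^ (n - 1) * (1 + (r / lam) ^ 2) by
      rw [← Real.rpow_add_one hD.ne', sub_add_cancel],
    mul_inv, ← mul_assoc, ← hsum, mul_inv_cancel_right₀ hD.ne']

theorem classification_ground_state (n : ℝ) (hn : 1 < n)
    (u v : ℝ → ℝ)
    (hu : ∀ r ∈ Set.Ioi (0 : ℝ), HasDerivAt u
      (v r * (u r ^ 2 + v r ^ 2) ^ ((1 : ℝ) / (n - 1)) - (n - 1) / r * u r) r)
    (hv : ∀ r ∈ Set.Ioi (0 : ℝ), HasDerivAt v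
      (-(u r * (u r ^ 2 + v r ^ 2) ^ ((1 : ℝ) / (n - 1)))) r)
    (hu0 : Tendsto (fun r : ℝ => r ^ ((n - 1) / 2) * u r) (nhdsWithin 0 (Set.Ioi 0)) (nhds 0))
    (hv0 : Tendsto (fun r : ℝ => r ^ ((n - 1) / 2) * v r) (nhdsWithin 0 (Set.Ioi 0)) (nhds 0)) :
    (∀ r ∈ Set.Ioi (0 : ℝ), u r = 0 ∧ v r = 0) ∨
    ∃ lam : ℝ, 0 < lam ∧ ∃ σ : ℝ, (σ = 1 ∨ σ = -1) ∧
      ∀ r ∈ Set.Ioi (0 : ℝ),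
        u r = σ * lam ^ (-(n - 1) / 2) * n ^ ((n - 1) / 2) *
          (1 + (r / lam) ^ 2) ^ (-n / 2) * (r / lam) ∧
        v r = σ * lam ^ (-(n - 1) / 2) * n ^ ((n - 1) / 2) *
          (1 + (r / lam) ^ 2) ^ (-n / 2) := by
  have hn0 : 0 < n := by linarith
  have hρ : ∀ r ∈ Set.Ioi (0 : ℝ), HasDerivAt (fun r => u r ^ 2 + v r ^ 2)
      (-(2 * (n - 1) / r * u r ^ 2)) r := by
    intro r hr
    refine (((hu r hr).pow 2).add ((hv r hr).pow 2)).congr_deriv ?_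
    push_cast
    ring
  by_cases hz : ∃ s, 0 < s ∧ u s ^ 2 + v s ^ 2 = 0
  · obtain ⟨s, hs, hs0⟩ := hz
    left
    intro r hr
    have h : u r ^ 2 + v r ^ 2 = 0 :=
      eq_zero_of_hasDerivAt_neg_sq hn hρ (fun r => by nlinarith [sq_nonneg (v r)]) hs hs0 hr
    constructor <;> nlinarith [sq_nonneg (u r), sq_nonneg (v r)]
  right
  have hpos : ∀ r ∈ Set.Ioi (0 : ℝ), 0 < u r ^ 2 + v r ^ 2 := fun r hr =>
    lt_of_le_of_ne (by positivity) fun h => hz ⟨r, hr, h.symm⟩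
  have hH := fun {r : ℝ} (hr : 0 < r) => hamiltonian_eq_zero hn hu hv hρ hpos hu0 hv0 hr
  have huv : ∀ r ∈ Set.Ioi (0 : ℝ), 0 < u r * v r := by
    intro r hr
    have hr' : 0 < r := hr
    have hp := hpos r hr
    have h : 0 < n * (u r * v r) := by
      rw [← hH hr']
      positivity
    exact pos_of_mul_pos_right h hn0.le
  have hv_ne : ∀ r ∈ Set.Ioi (0 : ℝ), v r ≠ 0 := fun r hr => right_ne_zero_of_mul (huv r hr).ne'
  have hq : ∀ r ∈ Set.Ioi (0 : ℝ), HasDerivAt (fun r => u r / (r * v r)) 0 r := by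
    intro r hr
    have hr' : 0 < r := hr
    have hvr := hv_ne r hr
    refine ((hu r hr).div ((hasDerivAt_id r).mul (hv r hr))
      (mul_ne_zero hr'.ne' hvr)).congr_deriv ?_
    simp only [Pi.mul_apply, id]
    rw [div_eq_zero_iff]
    left
    have h := hH hr'
    field_simp
    linear_combination h
  obtain ⟨lam, hlam, hu_eq⟩ : ∃ lam : ℝ, 0 < lam ∧ ∀ r ∈ Set.Ioi (0 : ℝ),
      u r = r / lam * v r := by
    have h1 := huv 1 (Set.mem_Ioi.2 one_pos)
    have hv1 := hv_ne 1 (Set.mem_Ioi.2 one_pos)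
    have hu1 := left_ne_zero_of_mul h1.ne'
    refine ⟨v 1 / u 1, ?_, fun r hr => ?_⟩
    · rw [show v 1 / u 1 = u 1 * v 1 / u 1 ^ 2 by field_simp]
      positivity
    · have hr' : 0 < r := hr
      have hvr := hv_ne r hr
      have h := eq_of_hasDerivAt_zero_Ioi hq hr' one_pos
      field_simp at h ⊢
      linear_combination h
  refine ⟨lam, hlam, ?_⟩
  set G : ℝ → ℝ := fun r =>
    lam ^ (-(n - 1) / 2) * n ^ ((n - 1) / 2) * (1 + (r / lam) ^ 2) ^ (-n / 2) with hG
  have hG_ne : ∀ {r : ℝ}, r ∈ Set.Ioi (0 : ℝ) → G r ≠ 0 := by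
    intro r _
    have : 0 < G r := by positivity
    exact this.ne'
  have hG_cont : ContinuousOn G (Set.Ioi 0) := by
    refine (continuous_const.mul
      (Continuous.rpow_const (by fun_prop) fun r => Or.inl ?_)).continuousOn
    positivity
  have hv_cont : ContinuousOn v (Set.Ioi 0) :=
    fun r hr => (hv r hr).continuousAt.continuousWithinAt
  have hsq : Set.EqOn (v ^ 2) (G ^ 2) (Set.Ioi 0) := fun r hr =>
    sq_eq_of_hamiltonian_eq_zero hn hlam hr (hu_eq r hr) (hpos r hr) (hH hr)
  rcases isPreconnected_Ioi.eq_or_eq_neg_of_sq_eq hv_cont hG_cont hsq hG_ne with h | h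
  · refine ⟨1, Or.inl rfl, fun r hr => ?_⟩
    rw [hu_eq r hr, h hr, hG]
    constructor <;> ring
  · refine ⟨-1, Or.inr rfl, fun r hr => ?_⟩
    rw [hu_eq r hr, h hr, Pi.neg_apply, hG]
    constructor <;> ring
end

section
/- Let n > 1 be a real number and let u, v : (0,∞) → ℝ be differentiable functions satisfying, for all r > 0, u'(r) + ((n−1)/r) u(r) = v(r) (u(r)² + v(r)²)^{1/(n−1)} and v'(r) = −u(r) (u(r)² + v(r)²)^{1/(n−1)}, together with the boundary conditions at infinity lim_{r→∞} r^{(n−1)/2} u(r) = 0 and lim_{r→∞} r^{(n−1)/2} v(r) = 0. Then either u and v are identically zero, or there exist λ > 0 and σ ∈ {+1, −1} such that for all r > 0: u(r) = σ λ^{-(n−1)/2} n^{(n−1)/2} (1 + (r/λ)²)^{-n/2} (r/λ) and v(r) = σ λ^{-(n−1)/2} n^{(n−1)/2} (1 + (r/λ)²)^{-n/2}. -/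
open Filter Topology

/-- A function with vanishing derivative on the positive half-line is constant there. -/
lemma eq_of_hasDerivAt_zero_Ioi_s13 {f : ℝ → ℝ}
    (hf : ∀ r ∈ Set.Ioi (0 : ℝ), HasDerivAt f 0 r) {a b : ℝ} (ha : 0 < a) (hb : 0 < b) :
    f a = f b :=
  isOpen_Ioi.is_const_of_deriv_eq_zero isPreconnected_Ioi
    (fun r hr => (hf r hr).differentiableAt.differentiableWithinAt)
    (fun r hr => (hf r hr).deriv) ha hb

section DiracSystem

variable {n : ℝ} {u v : ℝ → ℝ}

/-- The squared modulus `u² + v²` of a solution satisfies `(u² + v²)' = -2 (n - 1) u² / r`. -/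
lemma hasDerivAt_sq_add_sq {r : ℝ}
    (hu : HasDerivAt u
      (v r * (u r ^ 2 + v r ^ 2) ^ ((1 : ℝ) / (n - 1)) - (n - 1) / r * u r) r)
    (hv : HasDerivAt v (-(u r * (u r ^ 2 + v r ^ 2) ^ ((1 : ℝ) / (n - 1)))) r) :
    HasDerivAt (fun s => u s ^ 2 + v s ^ 2) (-(2 * (n - 1) / r * u r ^ 2)) r := by
  refine ((hu.fun_pow 2).fun_add (hv.fun_pow 2)).congr_deriv ?_
  push_cast
  ring

/-- A solution that vanishes at one positive radius vanishes at all positive radii. -/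
lemma sq_add_sq_eq_zero_of_eq_zero (hn : 1 < n)
    (hu : ∀ r ∈ Set.Ioi (0 : ℝ), HasDerivAt u
      (v r * (u r ^ 2 + v r ^ 2) ^ ((1 : ℝ) / (n - 1)) - (n - 1) / r * u r) r)
    (hv : ∀ r ∈ Set.Ioi (0 : ℝ), HasDerivAt v
      (-(u r * (u r ^ 2 + v r ^ 2) ^ ((1 : ℝ) / (n - 1)))) r)
    {a b : ℝ} (ha : 0 < a) (hb : 0 < b) (h : u a ^ 2 + v a ^ 2 = 0) :
    u b ^ 2 + v b ^ 2 = 0 := by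
  have hd : ∀ r ∈ Set.Ioi (0 : ℝ), HasDerivAt (fun s => u s ^ 2 + v s ^ 2)
      (-(2 * (n - 1) / r * u r ^ 2)) r :=
    fun r hr => hasDerivAt_sq_add_sq (hu r hr) (hv r hr)
  have hn' : 0 < n - 1 := sub_pos.2 hn
  rcases le_total a b with hab | hab
  · have hanti : AntitoneOn (fun s => u s ^ 2 + v s ^ 2) (Set.Ioi 0) := by
      refine antitoneOn_of_hasDerivWithinAt_nonpos
        (f' := fun r => -(2 * (n - 1) / r * u r ^ 2)) (convex_Ioi 0)
        (fun r hr => (hd r hr).continuousAt.continuousWithinAt)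
        (fun r hr => (hd r (interior_subset hr)).hasDerivWithinAt) (fun r hr => ?_)
      have hr : 0 < r := interior_subset hr
      have : 0 ≤ 2 * (n - 1) / r * u r ^ 2 := by positivity
      linarith
    have := hanti ha hb hab
    simp only [h] at this
    exact le_antisymm this (by positivity)
  · have hd' : ∀ r ∈ Set.Ioi (0 : ℝ),
        HasDerivAt (fun s => s ^ (2 * (n - 1)) * (u s ^ 2 + v s ^ 2))
          (r ^ (2 * (n - 1)) * (2 * (n - 1) / r * v r ^ 2)) r := by
      intro r hr
      have hr0 : r ≠ 0 := ne_of_gt hr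
      refine ((Real.hasDerivAt_rpow_const (p := 2 * (n - 1)) (Or.inl hr0)).fun_mul
        (hd r hr)).congr_deriv ?_
      rw [Real.rpow_sub_one hr0]
      field_simp
      ring
    have hmono : MonotoneOn (fun s => s ^ (2 * (n - 1)) * (u s ^ 2 + v s ^ 2)) (Set.Ioi 0) := by
      refine monotoneOn_of_hasDerivWithinAt_nonneg
        (f' := fun r => r ^ (2 * (n - 1)) * (2 * (n - 1) / r * v r ^ 2)) (convex_Ioi 0)
        (fun r hr => (hd' r hr).continuousAt.continuousWithinAt)
        (fun r hr => (hd' r (interior_subset hr)).hasDerivWithinAt) (fun r hr => ?_)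
      have hr : 0 < r := interior_subset hr
      positivity
    have hle := hmono hb ha hab
    simp only [h, mul_zero] at hle
    exact le_antisymm (nonpos_of_mul_nonpos_right hle (Real.rpow_pos_of_pos hb _))
      (by positivity)

/-- The conserved energy of a solution decaying at infinity is zero. -/
lemma mul_rpow_eq_of_tendsto_zero (hn : 1 < n)
    (hu : ∀ r ∈ Set.Ioi (0 : ℝ), HasDerivAt u
      (v r * (u r ^ 2 + v r ^ 2) ^ ((1 : ℝ) / (n - 1)) - (n - 1) / r * u r) r)
    (hv : ∀ r ∈ Set.Ioi (0 : ℝ), HasDerivAt v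
      (-(u r * (u r ^ 2 + v r ^ 2) ^ ((1 : ℝ) / (n - 1)))) r)
    (hu0 : Tendsto (fun r : ℝ => r ^ ((n - 1) / 2) * u r) atTop (nhds 0))
    (hv0 : Tendsto (fun r : ℝ => r ^ ((n - 1) / 2) * v r) atTop (nhds 0))
    (hpos : ∀ r ∈ Set.Ioi (0 : ℝ), 0 < u r ^ 2 + v r ^ 2) {r : ℝ} (hr : 0 < r) :
    r * ((u r ^ 2 + v r ^ 2) ^ ((1 : ℝ) / (n - 1)) * (u r ^ 2 + v r ^ 2)) =
      n * (u r * v r) := by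
  have hn' : 0 < n - 1 := sub_pos.2 hn
  set p : ℝ := 1 / (n - 1) with hp
  have hp0 : 0 < p := by positivity
  have hpn : (p + 1) * (n - 1) = n := by rw [hp]; field_simp; ring
  let E : ℝ → ℝ := fun s => s ^ (n - 1) *
    (s * (u s ^ 2 + v s ^ 2) ^ (p + 1) - n * (u s * v s))
  have hE : ∀ s ∈ Set.Ioi (0 : ℝ), HasDerivAt E 0 s := by
    intro s hs
    have hs0 : s ≠ 0 := ne_of_gt hs
    have hρ := hpos s hs
    refine ((Real.hasDerivAt_rpow_const (p := n - 1) (Or.inl hs0)).fun_mul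
      (((hasDerivAt_id' s).fun_mul
        ((hasDerivAt_sq_add_sq (hu s hs) (hv s hs)).rpow_const (p := p + 1)
          (Or.inl hρ.ne'))).fun_sub
        (((hu s hs).fun_mul (hv s hs)).const_mul n))).congr_deriv ?_
    rw [Real.rpow_sub_one hs0, add_sub_cancel_right, Real.rpow_add_one hρ.ne']
    generalize (u s ^ 2 + v s ^ 2) ^ p = A
    have hps : p = n / (n - 1) - 1 := by rw [hp]; field_simp; ring
    rw [hps]
    field_simp
    ring
  have hlim : Tendsto E atTop (𝓝 0) := by
    have h1 : Tendsto (fun s : ℝ => ((s ^ ((n - 1) / 2) * u s) ^ 2 +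
        (s ^ ((n - 1) / 2) * v s) ^ 2) ^ (p + 1) -
        n * ((s ^ ((n - 1) / 2) * u s) * (s ^ ((n - 1) / 2) * v s))) atTop
        (𝓝 ((0 ^ 2 + 0 ^ 2 : ℝ) ^ (p + 1) - n * (0 * 0))) :=
      (((hu0.pow 2).add (hv0.pow 2)).rpow_const (Or.inr (by positivity))).sub
        ((hu0.mul hv0).const_mul n)
    have h2 : ((0 ^ 2 + 0 ^ 2 : ℝ) ^ (p + 1) - n * (0 * 0)) = 0 := by
      rw [show (0 ^ 2 + 0 ^ 2 : ℝ) = 0 by norm_num, Real.zero_rpow (by positivity)]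
      ring
    rw [h2] at h1
    refine h1.congr' ?_
    filter_upwards [eventually_gt_atTop 0] with s hs
    have hsq : s ^ ((n - 1) / 2) * s ^ ((n - 1) / 2) = s ^ (n - 1) := by
      rw [← Real.rpow_add hs, add_halves]
    have hsum : (s ^ ((n - 1) / 2) * u s) ^ 2 + (s ^ ((n - 1) / 2) * v s) ^ 2 =
        s ^ (n - 1) * (u s ^ 2 + v s ^ 2) := by rw [← hsq]; ring
    have hpow : (s ^ (n - 1)) ^ (p + 1) = s ^ (n - 1) * s := by
      rw [← Real.rpow_mul hs.le, mul_comm, hpn, ← Real.rpow_add_one hs.ne', sub_add_cancel]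
    rw [hsum, Real.mul_rpow (by positivity) (by positivity), hpow]
    simp only [E]
    rw [← hsq]
    ring
  have hE0 : E r = 0 := by
    refine tendsto_nhds_unique (tendsto_const_nhds.congr' ?_) hlim
    filter_upwards [eventually_gt_atTop 0] with s hs
    exact eq_of_hasDerivAt_zero_Ioi_s13 hE hr hs
  have := (mul_eq_zero.1 hE0).resolve_left (Real.rpow_pos_of_pos hr _).ne'
  rw [Real.rpow_add_one (hpos r hr).ne'] at this
  linarith

end DiracSystem

theorem classification_ground_state_at_infinity (n : ℝ) (hn : 1 < n)
    (u v : ℝ → ℝ)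
    (hu : ∀ r ∈ Set.Ioi (0 : ℝ), HasDerivAt u
      (v r * (u r ^ 2 + v r ^ 2) ^ ((1 : ℝ) / (n - 1)) - (n - 1) / r * u r) r)
    (hv : ∀ r ∈ Set.Ioi (0 : ℝ), HasDerivAt v
      (-(u r * (u r ^ 2 + v r ^ 2) ^ ((1 : ℝ) / (n - 1)))) r)
    (hu0 : Tendsto (fun r : ℝ => r ^ ((n - 1) / 2) * u r) atTop (nhds 0))
    (hv0 : Tendsto (fun r : ℝ => r ^ ((n - 1) / 2) * v r) atTop (nhds 0)) :
    (∀ r ∈ Set.Ioi (0 : ℝ), u r = 0 ∧ v r = 0) ∨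
    ∃ lam : ℝ, 0 < lam ∧ ∃ σ : ℝ, (σ = 1 ∨ σ = -1) ∧
      ∀ r ∈ Set.Ioi (0 : ℝ),
        u r = σ * lam ^ (-(n - 1) / 2) * n ^ ((n - 1) / 2) *
          (1 + (r / lam) ^ 2) ^ (-n / 2) * (r / lam) ∧
        v r = σ * lam ^ (-(n - 1) / 2) * n ^ ((n - 1) / 2) *
          (1 + (r / lam) ^ 2) ^ (-n / 2) := by
  by_cases hz : ∃ a ∈ Set.Ioi (0 : ℝ), u a ^ 2 + v a ^ 2 = 0
  · obtain ⟨a, ha, h⟩ := hz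
    left
    intro r hr
    have hr' := sq_add_sq_eq_zero_of_eq_zero hn hu hv ha hr h
    constructor <;> nlinarith [sq_nonneg (u r), sq_nonneg (v r)]
  right
  have hn' : 0 < n - 1 := sub_pos.2 hn
  have hn0 : 0 < n := by linarith
  have hpos : ∀ r ∈ Set.Ioi (0 : ℝ), 0 < u r ^ 2 + v r ^ 2 := fun r hr =>
    lt_of_le_of_ne (by positivity) (fun h => hz ⟨r, hr, h.symm⟩)
  have hH : ∀ r ∈ Set.Ioi (0 : ℝ),
      r * ((u r ^ 2 + v r ^ 2) ^ ((1 : ℝ) / (n - 1)) * (u r ^ 2 + v r ^ 2)) =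
        n * (u r * v r) :=
    fun r hr => mul_rpow_eq_of_tendsto_zero hn hu hv hu0 hv0 hpos hr
  have huv : ∀ r ∈ Set.Ioi (0 : ℝ), 0 < u r * v r := fun r hr => by
    have h1 := hpos r hr
    have hr' : 0 < r := hr
    have h2 : 0 < n * (u r * v r) := by rw [← hH r hr]; positivity
    exact pos_of_mul_pos_right h2 hn0.le
  have hvne : ∀ r ∈ Set.Ioi (0 : ℝ), v r ≠ 0 := fun r hr => right_ne_zero_of_mul (huv r hr).ne'
  have hw : ∀ r ∈ Set.Ioi (0 : ℝ), HasDerivAt (fun s => u s / (s * v s)) 0 r := by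
    intro r hr
    have hr0 : r ≠ 0 := ne_of_gt hr
    have hv' := hvne r hr
    refine ((hu r hr).fun_div ((hasDerivAt_id' r).fun_mul (hv r hr))
      (mul_ne_zero hr0 hv')).congr_deriv ?_
    have h := hH r hr
    revert h
    generalize (u r ^ 2 + v r ^ 2) ^ ((1 : ℝ) / (n - 1)) = A
    intro h
    rw [div_eq_zero_iff]
    left
    field_simp
    linear_combination h
  have h1 : (1 : ℝ) ∈ Set.Ioi (0 : ℝ) := Set.mem_Ioi.2 one_pos
  have hlam : 0 < v 1 / u 1 := by
    have := huv 1 h1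
    rcases pos_and_pos_or_neg_and_neg_of_mul_pos this with h | h
    · exact div_pos h.2 h.1
    · exact div_pos_of_neg_of_neg h.2 h.1
  obtain ⟨lam, hl⟩ : ∃ lam, lam = v 1 / u 1 := ⟨_, rfl⟩
  rw [← hl] at hlam
  have hulam : ∀ r ∈ Set.Ioi (0 : ℝ), u r = v r * (r / lam) := by
    intro r hr
    have hr0 : r ≠ 0 := ne_of_gt hr
    have hv' := hvne r hr
    have h := eq_of_hasDerivAt_zero_Ioi_s13 hw hr h1
    have hinv : u 1 / (1 * v 1) = lam⁻¹ := by rw [hl, inv_div, one_mul]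
    simp only [hinv] at h
    rw [div_eq_iff (mul_ne_zero hr0 hv')] at h
    rw [h]
    ring
  have hsign : ∃ σ : ℝ, (σ = 1 ∨ σ = -1) ∧ ∀ r ∈ Set.Ioi (0 : ℝ), v r = σ * |v r| := by
    have hc : ContinuousOn v (Set.Ioi 0) :=
      fun r hr => (hv r hr).continuousAt.continuousWithinAt
    have himg := isPreconnected_Ioi.image v hc
    rcases lt_or_gt_of_ne (hvne 1 h1) with h | h
    · refine ⟨-1, Or.inr rfl, fun r hr => ?_⟩
      have : v r < 0 := by
        by_contra! hge
        obtain ⟨s, hs, hs0⟩ := himg.Icc_subset ⟨1, h1, rfl⟩ ⟨r, hr, rfl⟩ ⟨h.le, hge⟩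
        exact hvne s hs hs0
      rw [abs_of_neg this]; ring
    · refine ⟨1, Or.inl rfl, fun r hr => ?_⟩
      have : 0 < v r := by
        by_contra! hge
        obtain ⟨s, hs, hs0⟩ := himg.Icc_subset ⟨r, hr, rfl⟩ ⟨1, h1, rfl⟩ ⟨hge, h.le⟩
        exact hvne s hs hs0
      rw [abs_of_pos this]; ring
  obtain ⟨σ, hσ, hvσ⟩ := hsign
  refine ⟨lam, hlam, σ, hσ, fun r hr => ?_⟩
  have habs : |v r| = lam ^ (-(n - 1) / 2) * n ^ ((n - 1) / 2) *
      (1 + (r / lam) ^ 2) ^ (-n / 2) := by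
    have hr' : 0 < r := hr
    have hv2 : 0 < v r ^ 2 := by have := hvne r hr; positivity
    have hs : 0 < 1 + (r / lam) ^ 2 := by positivity
    have h := hH r hr
    have hρ : u r ^ 2 + v r ^ 2 = v r ^ 2 * (1 + (r / lam) ^ 2) := by
      rw [hulam r hr]; ring
    rw [hρ, Real.mul_rpow hv2.le hs.le, hulam r hr] at h
    have hq : (1 + (r / lam) ^ 2) ^ ((1 : ℝ) / (n - 1)) * (1 + (r / lam) ^ 2) =
        (1 + (r / lam) ^ 2) ^ (n / (n - 1)) := by
      rw [← Real.rpow_add_one hs.ne']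
      congr 1
      field_simp
      ring
    have hA : (v r ^ 2) ^ ((1 : ℝ) / (n - 1)) =
        lam⁻¹ * n * (1 + (r / lam) ^ 2) ^ (-(n / (n - 1))) := by
      rw [Real.rpow_neg hs.le, ← div_eq_mul_inv, eq_div_iff (by positivity), ← hq]
      have hne : r * v r ^ 2 ≠ 0 := by positivity
      apply mul_left_cancel₀ hne
      linear_combination h
    have hroot : ((v r ^ 2) ^ ((1 : ℝ) / (n - 1))) ^ ((n - 1) / 2) = |v r| := by
      rw [← Real.rpow_mul hv2.le, ← Real.sqrt_sq_eq_abs, Real.sqrt_eq_rpow]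
      congr 1
      field_simp
    rw [← hroot, hA, Real.mul_rpow (by positivity) (by positivity),
      Real.mul_rpow (by positivity) hn0.le, ← Real.rpow_mul hs.le, Real.inv_rpow hlam.le,
      ← Real.rpow_neg hlam.le, neg_div]
    congr 2
    field_simp
  have hvr : v r = σ * lam ^ (-(n - 1) / 2) * n ^ ((n - 1) / 2) *
      (1 + (r / lam) ^ 2) ^ (-n / 2) := by
    rw [hvσ r hr, habs]; ring
  exact ⟨by rw [← hvr]; exact hulam r hr, hvr⟩
end

section
/- Let β₁, β₂ > 0 and S ∈ ℤ, set a = (|2S+1|/(β₁+2β₂))^{1/2} and τ = sgn(S+1/2), and let (Q,P) be a pair of differentiable functions on (0,∞) solving Q' + ((S+1)/r) Q = P(β₁P² + 2β₂Q²), P' − (S/r) P = −Q(β₁Q² + 2β₂P²) with Q(1) = a, P(1) = τa. If u, v : (0,∞) → ℝ are differentiable and satisfy, for all r > 0, u'(r) + ((S+1)/r) u(r) = v(r)(β₁ v(r)² + 2β₂ u(r)²) and v'(r) − (S/r) v(r) = −u(r)(β₁ u(r)² + 2β₂ v(r)²), together with lim_{r→0⁺} r^{1/2} u(r) = 0 and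 lim_{r→0⁺} r^{1/2} v(r) = 0, and (u,v) is not identically (0,0), then there exist λ > 0 and σ ∈ {+1, −1} such that u(r) = σ λ^{-1/2} Q(r/λ) and v(r) = σ λ^{-1/2} P(r/λ) for all r > 0. -/
open Filter Topology

/-- In the logarithmic variable `t = log r`, the rescaled pair `(r^{1/2} u, r^{1/2} v)` solves this
autonomous Hamiltonian system, with `k = S + 1/2`. -/
structure IsLogFlow (β₁ β₂ k : ℝ) (X Y : ℝ → ℝ) : Prop where
  hasDerivAt_fst : ∀ t, HasDerivAt X (Y t * (β₁ * Y t ^ 2 + 2 * β₂ * X t ^ 2) - k * X t) t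
  hasDerivAt_snd : ∀ t, HasDerivAt Y (k * Y t - X t * (β₁ * X t ^ 2 + 2 * β₂ * Y t ^ 2)) t

/-- Four times the Hamiltonian of the flow `IsLogFlow`. -/
def energy (β₁ β₂ k x y : ℝ) : ℝ :=
  β₁ * (x ^ 4 + y ^ 4) + 4 * β₂ * (x ^ 2 * y ^ 2) - 4 * k * (x * y)

lemma mul_pos_of_energy_eq_zero {β₁ β₂ k x y : ℝ} (hβ₁ : 0 < β₁) (hβ₂ : 0 < β₂)
    (hE : energy β₁ β₂ k x y = 0) (hne : x ^ 2 + y ^ 2 ≠ 0) : 0 < k * (x * y) := by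
  unfold energy at hE
  have hpos : 0 < x ^ 4 + y ^ 4 := by
    have : 0 < (x ^ 2 + y ^ 2) ^ 2 := by positivity
    nlinarith [sq_nonneg (x ^ 2 - y ^ 2)]
  have h₁ : 0 < β₁ * (x ^ 4 + y ^ 4) := mul_pos hβ₁ hpos
  have h₂ : 0 ≤ 4 * β₂ * (x ^ 2 * y ^ 2) := by positivity
  linarith

lemma abs_mul_le_of_energy_eq_zero {β₁ β₂ k x y : ℝ} (hβ₁ : 0 < β₁) (hβ₂ : 0 < β₂)
    (hE : energy β₁ β₂ k x y = 0) : |x * y| ≤ 2 * |k| / β₁ := by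
  unfold energy at hE
  rw [le_div_iff₀ hβ₁]
  rcases eq_or_ne (x * y) 0 with h | h
  · rw [h]; simp
  have hp : 0 < |x * y| := abs_pos.mpr h
  have h₁ : β₁ * (2 * |x * y| ^ 2) ≤ β₁ * (x ^ 4 + y ^ 4) := by
    rw [sq_abs]
    apply mul_le_mul_of_nonneg_left _ hβ₁.le
    nlinarith [sq_nonneg (x ^ 2 - y ^ 2)]
  have h₂ : 0 ≤ 4 * β₂ * (x ^ 2 * y ^ 2) := by positivity
  have h₃ : k * (x * y) ≤ |k| * |x * y| := by rw [← abs_mul]; exact le_abs_self _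
  have h₄ : |x * y| * (|x * y| * β₁) ≤ |x * y| * (2 * |k|) := by linarith
  exact le_of_mul_le_mul_left h₄ hp

namespace IsLogFlow

variable {β₁ β₂ k : ℝ} {X Y : ℝ → ℝ}

lemma shift (h : IsLogFlow β₁ β₂ k X Y) (t₀ : ℝ) :
    IsLogFlow β₁ β₂ k (fun s => X (s + t₀)) (fun s => Y (s + t₀)) where
  hasDerivAt_fst s := (h.hasDerivAt_fst (s + t₀)).comp_add_const s t₀
  hasDerivAt_snd s := (h.hasDerivAt_snd (s + t₀)).comp_add_const s t₀

lemma energy_eq (h : IsLogFlow β₁ β₂ k X Y) (s t : ℝ) :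
    energy β₁ β₂ k (X s) (Y s) = energy β₁ β₂ k (X t) (Y t) := by
  have hd : ∀ t, HasDerivAt (fun t => energy β₁ β₂ k (X t) (Y t)) 0 t := fun t => by
    have hX := h.hasDerivAt_fst t
    have hY := h.hasDerivAt_snd t
    have := ((((hX.pow 4).add (hY.pow 4)).const_mul β₁).add
      (((hX.pow 2).mul (hY.pow 2)).const_mul (4 * β₂))).sub ((hX.mul hY).const_mul (4 * k))
    refine this.congr_deriv ?_
    simp only [Pi.pow_apply]
    push_cast
    ring
  exact is_const_of_deriv_eq_zero (fun t => (hd t).differentiableAt) (fun t => (hd t).deriv) s t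

/-- On the zero energy level, a solution that vanishes somewhere is trivial. -/
lemma sq_add_sq_ne_zero (hβ₁ : 0 < β₁) (hβ₂ : 0 < β₂) (h : IsLogFlow β₁ β₂ k X Y)
    (hE : ∀ t, energy β₁ β₂ k (X t) (Y t) = 0) {t₀ : ℝ} (h₀ : X t₀ ^ 2 + Y t₀ ^ 2 ≠ 0) (t : ℝ) :
    X t ^ 2 + Y t ^ 2 ≠ 0 := by
  set C : ℝ := 2 * (|k| + |β₁ - 2 * β₂| * (2 * |k| / β₁)) with hC
  set D : ℝ → ℝ := fun t => 2 * (Y t ^ 2 - X t ^ 2) * (k + (β₁ - 2 * β₂) * (X t * Y t)) with hD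
  have hN : ∀ t, HasDerivAt (fun t => X t ^ 2 + Y t ^ 2) (D t) t := fun t => by
    refine (((h.hasDerivAt_fst t).pow 2).add ((h.hasDerivAt_snd t).pow 2)).congr_deriv ?_
    simp only [hD]
    push_cast
    ring
  have hbound : ∀ t, |D t| ≤ C * (X t ^ 2 + Y t ^ 2) := fun t => by
    have h₁ : |k + (β₁ - 2 * β₂) * (X t * Y t)| ≤ |k| + |β₁ - 2 * β₂| * (2 * |k| / β₁) := by
      refine (abs_add_le _ _).trans ?_
      rw [abs_mul]
      gcongr
      exact abs_mul_le_of_energy_eq_zero hβ₁ hβ₂ (hE t)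
    have h₂ : |Y t ^ 2 - X t ^ 2| ≤ X t ^ 2 + Y t ^ 2 := by
      rw [abs_le]
      constructor <;> nlinarith [sq_nonneg (X t), sq_nonneg (Y t)]
    simp only [hD, abs_mul, abs_two]
    calc 2 * |Y t ^ 2 - X t ^ 2| * |k + (β₁ - 2 * β₂) * (X t * Y t)|
        ≤ 2 * (X t ^ 2 + Y t ^ 2) * (|k| + |β₁ - 2 * β₂| * (2 * |k| / β₁)) := by gcongr
      _ = C * (X t ^ 2 + Y t ^ 2) := by rw [hC]; ring
  have hexp : ∀ c t : ℝ, HasDerivAt (fun t => (X t ^ 2 + Y t ^ 2) * Real.exp (c * t))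
      ((D t + c * (X t ^ 2 + Y t ^ 2)) * Real.exp (c * t)) t := fun c t => by
    refine ((hN t).mul ((hasDerivAt_id t).const_mul c).exp).congr_deriv ?_
    simp only [id]
    ring
  have hmono : Monotone (fun t => (X t ^ 2 + Y t ^ 2) * Real.exp (C * t)) :=
    monotone_of_hasDerivAt_nonneg (hexp C) fun t =>
      mul_nonneg (by linarith [(abs_le.mp (hbound t)).1]) (Real.exp_pos _).le
  have hanti : Antitone (fun t => (X t ^ 2 + Y t ^ 2) * Real.exp (-C * t)) :=
    antitone_of_hasDerivAt_nonpos (hexp (-C)) fun t =>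
      mul_nonpos_of_nonpos_of_nonneg (by linarith [(abs_le.mp (hbound t)).2]) (Real.exp_pos _).le
  intro hzero
  have hpos : 0 < X t₀ ^ 2 + Y t₀ ^ 2 := by positivity
  rcases le_total t₀ t with hle | hle
  · have := hmono hle
    simp only [hzero, zero_mul] at this
    exact absurd this (not_le.mpr (mul_pos hpos (Real.exp_pos _)))
  · have := hanti hle
    simp only [hzero, zero_mul] at this
    exact absurd this (not_le.mpr (mul_pos hpos (Real.exp_pos _)))

/-- On the zero energy level the quotient of the components decays at the exponential rate `2 * k`. -/
lemma div_mul_exp_eq (h : IsLogFlow β₁ β₂ k X Y) (hE : ∀ t, energy β₁ β₂ k (X t) (Y t) = 0)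
    (hX : ∀ t, X t ≠ 0) (s t : ℝ) :
    Y s / X s * Real.exp (2 * k * s) = Y t / X t * Real.exp (2 * k * t) := by
  have hd : ∀ t, HasDerivAt (fun t => Y t / X t * Real.exp (2 * k * t)) 0 t := fun t => by
    have hEt := hE t
    unfold energy at hEt
    refine (((h.hasDerivAt_snd t).div (h.hasDerivAt_fst t) (hX t)).mul
      ((hasDerivAt_id t).const_mul (2 * k)).exp).congr_deriv ?_
    have hXt := hX t
    simp only [id, Pi.div_apply]
    generalize Real.exp (2 * k * t) = e
    field_simp
    linear_combination -e * hEt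
  exact is_const_of_deriv_eq_zero (fun t => (hd t).differentiableAt) (fun t => (hd t).deriv) s t

/-- Two nontrivial zero energy solutions with the same initial quotient agree up to sign. -/
lemma eq_or_eq_neg (hβ₁ : 0 < β₁) (hβ₂ : 0 < β₂) {A B : ℝ → ℝ}
    (h : IsLogFlow β₁ β₂ k X Y) (h' : IsLogFlow β₁ β₂ k A B)
    (hE : ∀ t, energy β₁ β₂ k (X t) (Y t) = 0) (hE' : ∀ t, energy β₁ β₂ k (A t) (B t) = 0)
    (hX : ∀ t, X t ≠ 0) (hA : ∀ t, A t ≠ 0) (h₀ : Y 0 / X 0 = B 0 / A 0) :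
    ∃ σ : ℝ, (σ = 1 ∨ σ = -1) ∧ ∀ t, X t = σ * A t ∧ Y t = σ * B t := by
  have hw : ∀ t, Y t / X t = B t / A t := fun t => by
    have h₁ := h.div_mul_exp_eq hE hX t 0
    have h₂ := h'.div_mul_exp_eq hE' hA t 0
    rw [h₀, ← h₂] at h₁
    exact mul_right_cancel₀ (Real.exp_pos _).ne' h₁
  have formula : ∀ x y : ℝ, x ≠ 0 → energy β₁ β₂ k x y = 0 →
      x ^ 2 = 4 * k * (y / x) / (β₁ * (1 + (y / x) ^ 4) + 4 * β₂ * (y / x) ^ 2) := by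
    intro x y hx hxy
    unfold energy at hxy
    rw [eq_div_iff (by positivity)]
    field_simp
    linear_combination hxy
  have hsq : ∀ t, X t ^ 2 = A t ^ 2 := fun t => by
    rw [formula _ _ (hX t) (hE t), formula _ _ (hA t) (hE' t), hw t]
  have hXc : Continuous X :=
    continuous_iff_continuousAt.mpr fun t => (h.hasDerivAt_fst t).continuousAt
  have hAc : Continuous A :=
    continuous_iff_continuousAt.mpr fun t => (h'.hasDerivAt_fst t).continuousAt
  have key : ∀ σ : ℝ, (∀ t, X t = σ * A t) → ∀ t, X t = σ * A t ∧ Y t = σ * B t := by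
    refine fun σ hσ t => ⟨hσ t, ?_⟩
    have hwt := hw t
    rw [div_eq_iff (hX t), hσ t] at hwt
    rw [hwt]
    have := hA t
    field_simp
  rcases isPreconnected_univ.eq_or_eq_neg_of_sq_eq hXc.continuousOn hAc.continuousOn
    (fun t _ => hsq t) (fun {t} _ => hA t) with he | he
  · exact ⟨1, Or.inl rfl, key 1 fun t => by rw [he (Set.mem_univ t), one_mul]⟩
  · exact ⟨-1, Or.inr rfl, key (-1) fun t => by rw [he (Set.mem_univ t), Pi.neg_apply, neg_one_mul]⟩

end IsLogFlow

/-- Passing to the logarithmic variable. -/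
lemma isLogFlow_of_radial {β₁ β₂ s : ℝ} {u v : ℝ → ℝ}
    (hu : ∀ r ∈ Set.Ioi (0 : ℝ), HasDerivAt u
      (v r * (β₁ * v r ^ 2 + 2 * β₂ * u r ^ 2) - (s + 1) / r * u r) r)
    (hv : ∀ r ∈ Set.Ioi (0 : ℝ), HasDerivAt v
      (s / r * v r - u r * (β₁ * u r ^ 2 + 2 * β₂ * v r ^ 2)) r) :
    IsLogFlow β₁ β₂ (s + 1 / 2) (fun t => Real.exp (t / 2) * u (Real.exp t))
      (fun t => Real.exp (t / 2) * v (Real.exp t)) := by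
  have hhalf : ∀ t : ℝ, HasDerivAt (fun t => Real.exp (t / 2)) (Real.exp (t / 2) * (1 / 2)) t :=
    fun t => ((hasDerivAt_id t).div_const 2).exp
  have hsq : ∀ t : ℝ, Real.exp t = Real.exp (t / 2) ^ 2 := fun t => by
    rw [← Real.exp_nat_mul]; congr 1; push_cast; ring
  constructor <;> intro t
  · refine ((hhalf t).mul ((hu _ (Real.exp_pos t)).comp t (Real.hasDerivAt_exp t))).congr_deriv ?_
    have := Real.exp_pos (t / 2)
    simp only [Function.comp_apply]
    generalize u (Real.exp t) = p
    generalize v (Real.exp t) = q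
    rw [hsq t]
    field_simp
    ring
  · refine ((hhalf t).mul ((hv _ (Real.exp_pos t)).comp t (Real.hasDerivAt_exp t))).congr_deriv ?_
    have := Real.exp_pos (t / 2)
    simp only [Function.comp_apply]
    generalize u (Real.exp t) = p
    generalize v (Real.exp t) = q
    rw [hsq t]
    field_simp
    ring

lemma tendsto_exp_half_mul {u : ℝ → ℝ}
    (hu : Tendsto (fun r : ℝ => r ^ ((1 : ℝ) / 2) * u r) (𝓝[>] 0) (𝓝 0)) :
    Tendsto (fun t => Real.exp (t / 2) * u (Real.exp t)) atBot (𝓝 0) := by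
  refine (hu.comp Real.tendsto_exp_atBot_nhdsGT).congr fun t => ?_
  simp only [Function.comp_apply, ← Real.exp_mul]
  ring_nf

theorem uniqueness_excited_states (β₁ β₂ : ℝ) (hβ₁ : 0 < β₁) (hβ₂ : 0 < β₂) (S : ℤ)
    (a : ℝ) (ha : a = (|2 * (S : ℝ) + 1| / (β₁ + 2 * β₂)) ^ ((1 : ℝ) / 2))
    (τ : ℝ) (hτ : τ = if (0 : ℝ) < (S : ℝ) + 1 / 2 then 1 else -1)
    (Q P : ℝ → ℝ)
    (hQ : ∀ r ∈ Set.Ioi (0 : ℝ), HasDerivAt Q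
      (P r * (β₁ * P r ^ 2 + 2 * β₂ * Q r ^ 2) - ((S : ℝ) + 1) / r * Q r) r)
    (hP : ∀ r ∈ Set.Ioi (0 : ℝ), HasDerivAt P
      ((S : ℝ) / r * P r - Q r * (β₁ * Q r ^ 2 + 2 * β₂ * P r ^ 2)) r)
    (hQ1 : Q 1 = a) (hP1 : P 1 = τ * a)
    (u v : ℝ → ℝ)
    (hu : ∀ r ∈ Set.Ioi (0 : ℝ), HasDerivAt u
      (v r * (β₁ * v r ^ 2 + 2 * β₂ * u r ^ 2) - ((S : ℝ) + 1) / r * u r) r)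
    (hv : ∀ r ∈ Set.Ioi (0 : ℝ), HasDerivAt v
      ((S : ℝ) / r * v r - u r * (β₁ * u r ^ 2 + 2 * β₂ * v r ^ 2)) r)
    (hu0 : Tendsto (fun r : ℝ => r ^ ((1 : ℝ) / 2) * u r) (nhdsWithin 0 (Set.Ioi 0)) (nhds 0))
    (hv0 : Tendsto (fun r : ℝ => r ^ ((1 : ℝ) / 2) * v r) (nhdsWithin 0 (Set.Ioi 0)) (nhds 0))
    (hnontriv : ¬ ∀ r ∈ Set.Ioi (0 : ℝ), u r = 0 ∧ v r = 0) :
    ∃ lam : ℝ, 0 < lam ∧ ∃ σ : ℝ, (σ = 1 ∨ σ = -1) ∧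
      ∀ r ∈ Set.Ioi (0 : ℝ),
        u r = σ * lam ^ (-(1 : ℝ) / 2) * Q (r / lam) ∧
        v r = σ * lam ^ (-(1 : ℝ) / 2) * P (r / lam) := by
  set k : ℝ := (S : ℝ) + 1 / 2 with hk
  have hk0 : k ≠ 0 := by
    intro h
    have h' : (2 * S + 1 : ℝ) = 0 := by rw [hk] at h; linarith
    have : 2 * S + 1 = 0 := by exact_mod_cast h'
    omega
  have hτk : τ * k = |k| ∧ (τ = 1 ∨ τ = -1) := by
    split_ifs at hτ with hpos
    · exact ⟨by rw [hτ, one_mul, abs_of_pos hpos], Or.inl hτ⟩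
    · exact ⟨by rw [hτ, abs_of_nonpos (not_lt.mp hpos)]; ring, Or.inr hτ⟩
  have hτ2 : τ ^ 2 = 1 := by rcases hτk.2 with h | h <;> simp [h]
  have hkabs : |2 * (S : ℝ) + 1| = 2 * |k| := by
    rw [← abs_two (α := ℝ), ← abs_mul, hk, abs_two]; ring_nf
  have hkpos : 0 < |k| := abs_pos.mpr hk0
  have hapos : 0 < a := by
    rw [ha, hkabs]
    positivity
  have ha2 : a ^ 2 * (β₁ + 2 * β₂) = 2 * |k| := by
    rw [ha, hkabs, ← Real.sqrt_eq_rpow, Real.sq_sqrt (by positivity)]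
    field_simp
  have hAB := isLogFlow_of_radial hQ hP
  have hXY := isLogFlow_of_radial hu hv
  set A : ℝ → ℝ := fun t => Real.exp (t / 2) * Q (Real.exp t) with hA
  set B : ℝ → ℝ := fun t => Real.exp (t / 2) * P (Real.exp t) with hB
  set X : ℝ → ℝ := fun t => Real.exp (t / 2) * u (Real.exp t) with hX
  set Y : ℝ → ℝ := fun t => Real.exp (t / 2) * v (Real.exp t) with hY
  have hA0 : A 0 = a := by simp [hA, hQ1]
  have hB0 : B 0 = τ * a := by simp [hB, hP1]
  have hEAB : ∀ t, energy β₁ β₂ k (A t) (B t) = 0 := fun t => by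
    rw [hAB.energy_eq t 0, hA0, hB0]
    unfold energy
    linear_combination (β₁ * a ^ 4 * (τ ^ 2 + 1) + 4 * β₂ * a ^ 4) * hτ2 + 2 * a ^ 2 * ha2
      - 4 * a ^ 2 * hτk.1
  have hEXY : ∀ t, energy β₁ β₂ k (X t) (Y t) = 0 := fun t => by
    have hX0 : Tendsto X atBot (𝓝 0) := tendsto_exp_half_mul hu0
    have hY0 : Tendsto Y atBot (𝓝 0) := tendsto_exp_half_mul hv0
    have hlim : Tendsto (fun s => energy β₁ β₂ k (X s) (Y s)) atBot (𝓝 0) := by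
      have := ((((hX0.pow 4).add (hY0.pow 4)).const_mul β₁).add
        (((hX0.pow 2).mul (hY0.pow 2)).const_mul (4 * β₂))).sub
        ((hX0.mul hY0).const_mul (4 * k))
      simpa [energy] using this
    have hconst : Tendsto (fun s => energy β₁ β₂ k (X s) (Y s)) atBot
        (𝓝 (energy β₁ β₂ k (X t) (Y t))) :=
      tendsto_const_nhds.congr fun s => hXY.energy_eq t s
    exact tendsto_nhds_unique hconst hlim
  have hposAB : ∀ t, 0 < k * (A t * B t) := fun t => by
    refine mul_pos_of_energy_eq_zero hβ₁ hβ₂ (hEAB t)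
      (hAB.sq_add_sq_ne_zero hβ₁ hβ₂ hEAB (t₀ := 0) ?_ t)
    rw [hA0]
    positivity
  have hposXY : ∀ t, 0 < k * (X t * Y t) := fun t => by
    push Not at hnontriv
    obtain ⟨r, hr, hne⟩ := hnontriv
    refine mul_pos_of_energy_eq_zero hβ₁ hβ₂ (hEXY t)
      (hXY.sq_add_sq_ne_zero hβ₁ hβ₂ hEXY (t₀ := Real.log r) ?_ t)
    simp only [hX, hY, Real.exp_log (Set.mem_Ioi.mp hr)]
    intro h0
    have hexp := Real.exp_pos (Real.log r / 2)
    have hur : u r = 0 := by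
      have : Real.exp (Real.log r / 2) * u r = 0 := by
        nlinarith [sq_nonneg (Real.exp (Real.log r / 2) * u r),
          sq_nonneg (Real.exp (Real.log r / 2) * v r)]
      exact (mul_eq_zero.mp this).resolve_left hexp.ne'
    have hvr : v r ≠ 0 := hne hur
    have : 0 < (Real.exp (Real.log r / 2) * v r) ^ 2 := by positivity
    nlinarith [sq_nonneg (Real.exp (Real.log r / 2) * u r)]
  have hAne : ∀ t, A t ≠ 0 := fun t h => by simpa [h] using hposAB t
  have hXne : ∀ t, X t ≠ 0 := fun t h => by simpa [h] using hposXY t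
  have hquot : 0 < τ * (Y 0 / X 0) := by
    have h₁ : 0 < |k| * (k * (X 0 * Y 0)) := mul_pos hkpos (hposXY 0)
    have hX0 := hXne 0
    have h₂ : τ * (Y 0 / X 0) = |k| * (k * (X 0 * Y 0)) / (k ^ 2 * X 0 ^ 2) := by
      rw [← hτk.1]
      field_simp
    rw [h₂]
    positivity
  set t₀ : ℝ := Real.log (τ * (Y 0 / X 0)) / (2 * k) with ht₀
  have hquot₀ : Y t₀ / X t₀ = τ := by
    have h₁ := hXY.div_mul_exp_eq hEXY hXne t₀ 0
    have h₂ : 2 * k * t₀ = Real.log (τ * (Y 0 / X 0)) := by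
      rw [ht₀]
      field_simp
    rw [h₂, Real.exp_log hquot, mul_zero, Real.exp_zero, mul_one] at h₁
    have h₃ : Y 0 / X 0 ≠ 0 := fun h => by simp [h] at hquot
    have h₄ : Y t₀ / X t₀ * τ = 1 := by
      apply mul_right_cancel₀ h₃
      linear_combination h₁
    linear_combination τ * h₄ - Y t₀ / X t₀ * hτ2
  obtain ⟨σ, hσ, hall⟩ := (hXY.shift t₀).eq_or_eq_neg hβ₁ hβ₂ hAB (fun t => hEXY _) hEAB
    (fun t => hXne _) hAne (by
      rw [zero_add, hquot₀, hA0, hB0]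
      field_simp)
  have hlam : Real.exp t₀ ^ (-(1 : ℝ) / 2) = Real.exp (-(t₀ / 2)) := by
    rw [← Real.exp_mul]
    ring_nf
  have hback : ∀ r : ℝ, 0 < r → ∀ p q : ℝ,
      Real.exp ((Real.log r - t₀ + t₀) / 2) * p = σ * (Real.exp ((Real.log r - t₀) / 2) * q) →
      p = σ * Real.exp t₀ ^ (-(1 : ℝ) / 2) * q := by
    intro r hr p q h
    rw [hlam]
    have hsplit : Real.exp ((Real.log r - t₀) / 2) =
        Real.exp ((Real.log r - t₀ + t₀) / 2) * Real.exp (-(t₀ / 2)) := by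
      rw [← Real.exp_add]
      ring_nf
    rw [hsplit] at h
    apply mul_left_cancel₀ (Real.exp_pos ((Real.log r - t₀ + t₀) / 2)).ne'
    linear_combination h
  refine ⟨Real.exp t₀, Real.exp_pos _, σ, hσ, fun r hr => ?_⟩
  have hr : 0 < r := hr
  have hexp₁ : Real.exp (Real.log r - t₀ + t₀) = r := by rw [sub_add_cancel, Real.exp_log hr]
  have hexp₂ : Real.exp (Real.log r - t₀) = r / Real.exp t₀ := by
    rw [Real.exp_sub, Real.exp_log hr]
  obtain ⟨h₁, h₂⟩ := hall (Real.log r - t₀)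
  simp only [hX, hY, hA, hB, hexp₁, hexp₂] at h₁ h₂
  exact ⟨hback r hr _ _ h₁, hback r hr _ _ h₂⟩
end

section
/- Let n > 1 be a real number and let f, g : ℝ → ℝ be differentiable functions satisfying, for all t ∈ ℝ, f'(t) + ((n−1)/2) f(t) = g(t)(f(t)² + g(t)²)^{1/(n−1)} and g'(t) − ((n−1)/2) g(t) = −f(t)(f(t)² + g(t)²)^{1/(n−1)}. Then the function ℰ(t) = −f(t)g(t) + (1/n)(f(t)² + g(t)²)^{n/(n−1)} is constant on ℝ. -/
theorem energy_conserved_radial (n : ℝ) (hn : 1 < n) (f g : ℝ → ℝ)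
    (hf : ∀ t : ℝ, HasDerivAt f
      (g t * (f t ^ 2 + g t ^ 2) ^ ((1 : ℝ) / (n - 1)) - (n - 1) / 2 * f t) t)
    (hg : ∀ t : ℝ, HasDerivAt g
      ((n - 1) / 2 * g t - f t * (f t ^ 2 + g t ^ 2) ^ ((1 : ℝ) / (n - 1))) t) :
    ∀ s t : ℝ,
      -(f s * g s) + 1 / n * (f s ^ 2 + g s ^ 2) ^ (n / (n - 1)) =
      -(f t * g t) + 1 / n * (f t ^ 2 + g t ^ 2) ^ (n / (n - 1)) := by
  have hn1 : 0 < n - 1 := sub_pos.mpr hn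
  have hn1' : n - 1 ≠ 0 := hn1.ne'
  have hn0 : n ≠ 0 := by linarith
  have hp : 1 ≤ n / (n - 1) := by rw [le_div_iff₀ hn1]; linarith
  have hp1 : n / (n - 1) - 1 = 1 / (n - 1) := by field_simp; ring
  have hE (t : ℝ) : HasDerivAt
      (fun t ↦ -(f t * g t) + 1 / n * (f t ^ 2 + g t ^ 2) ^ (n / (n - 1))) 0 t := by
    have hR := (((hf t).fun_pow 2).fun_add ((hg t).fun_pow 2)).rpow_const
      (p := n / (n - 1)) (Or.inr hp)
    refine ((((hf t).fun_mul (hg t)).fun_neg).fun_add (hR.const_mul (1 / n))).congr_deriv ?_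
    rw [hp1]
    generalize (f t ^ 2 + g t ^ 2) ^ ((1 : ℝ) / (n - 1)) = P
    push_cast
    field_simp
    ring
  exact is_const_of_deriv_eq_zero (fun t ↦ (hE t).differentiableAt) fun t ↦ (hE t).deriv
end

section
/- Let β₁, β₂ ∈ ℝ, S ∈ ℝ, and let f, g : ℝ → ℝ be differentiable functions satisfying, for all t ∈ ℝ, f'(t) + (S + 1/2) f(t) = g(t)(2β₂ f(t)² + β₁ g(t)²) and g'(t) − (S + 1/2) g(t) = −f(t)(β₁ f(t)² + 2β₂ g(t)²). Then the function ℰ(t) = (β₁/4)(f(t)⁴ + g(t)⁴) + β₂ f(t)² g(t)² − (S + 1/2) f(t) g(t) is constant on ℝ. -/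
theorem energy_conserved_excited (β₁ β₂ S : ℝ) (f g : ℝ → ℝ)
    (hf : ∀ t : ℝ, HasDerivAt f
      (g t * (2 * β₂ * f t ^ 2 + β₁ * g t ^ 2) - (S + 1 / 2) * f t) t)
    (hg : ∀ t : ℝ, HasDerivAt g
      ((S + 1 / 2) * g t - f t * (β₁ * f t ^ 2 + 2 * β₂ * g t ^ 2)) t) :
    ∀ s t : ℝ,
      β₁ / 4 * (f s ^ 4 + g s ^ 4) + β₂ * f s ^ 2 * g s ^ 2 - (S + 1 / 2) * (f s * g s) =
      β₁ / 4 * (f t ^ 4 + g t ^ 4) + β₂ * f t ^ 2 * g t ^ 2 - (S + 1 / 2) * (f t * g t) := by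
  have hE : ∀ t : ℝ, HasDerivAt (fun t => β₁ / 4 * (f t ^ 4 + g t ^ 4)
      + β₂ * f t ^ 2 * g t ^ 2 - (S + 1 / 2) * (f t * g t)) 0 t := by
    intro t
    have h := (((((hf t).fun_pow 4).fun_add ((hg t).fun_pow 4)).const_mul (β₁ / 4)).fun_add
      ((((hf t).fun_pow 2).const_mul β₂).fun_mul ((hg t).fun_pow 2))).fun_sub
      (((hf t).fun_mul (hg t)).const_mul (S + 1 / 2))
    refine h.congr_deriv ?_
    push_cast
    ring
  exact is_const_of_deriv_eq_zero (fun t => (hE t).differentiableAt) (fun t => (hE t).deriv)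
end
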